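/- arXiv:1312.1213 — 2 statements merged into one kernel-verified Lean document; each statement's English description precedes it below -/
import Mathlib

section
/- For every graph G with at least 5 vertices, one can delete at most 6 vertices so that the resulting induced subgraph contains three vertices with the same degree. -/
lemma aux_counts {V : Type*} [DecidableEq V] (p q r : V → Bool) (X : Finset V) :
    ∃ N : Bool → Bool → Bool → ℕ,
      (∀ x y z, N x y z = (X.filter (fun u => p u = x ∧ q u = y ∧ r u = z)).card) ∧
      X.card = N true true true + N true true false + N true false true + N true false false
        + N false true true + N false true false + N false false true + N false false false ∧
      (X.filter (fun u => p u = true)).card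
        = N true true true + N true true false + N true false true + N true false false ∧
      (X.filter (fun u => q u = true)).card
        = N true true true + N true true false + N false true true + N false true false ∧
      (X.filter (fun u => r u = true)).card
        = N true true true + N true false true + N false true true + N false false true := by
  refine ⟨_, fun _ _ _ => rfl, ?_⟩
  induction X using Finset.induction_on with
  | empty => simp
  | insert u X hu ih =>
    obtain ⟨h1, h2, h3, h4⟩ := ih
    cases hp : p u <;> cases hq : q u <;> cases hr : r u <;>
      simp [Finset.filter_insert, hp, hq, hr, hu] <;> omega

/-- A set all of whose nonempty subsets are unbalanced, with total imbalance at most 3,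
has at most 6 elements. -/
lemma aux_comb {V : Type*} [DecidableEq V] (p q r : V → Bool) (X : Finset V)
    (hmin : ∀ Z ⊆ X, Z.Nonempty →
      ¬ ((Z.filter (fun u => p u = true)).card = (Z.filter (fun u => q u = true)).card ∧
         (Z.filter (fun u => q u = true)).card = (Z.filter (fun u => r u = true)).card))
    (h1 : (X.filter (fun u => p u = true)).card ≤ (X.filter (fun u => q u = true)).card + 3)
    (h2 : (X.filter (fun u => p u = true)).card ≤ (X.filter (fun u => r u = true)).card + 3)
    (h3 : (X.filter (fun u => q u = true)).card ≤ (X.filter (fun u => p u = true)).card + 3)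
    (h4 : (X.filter (fun u => q u = true)).card ≤ (X.filter (fun u => r u = true)).card + 3)
    (h5 : (X.filter (fun u => r u = true)).card ≤ (X.filter (fun u => p u = true)).card + 3)
    (h6 : (X.filter (fun u => r u = true)).card ≤ (X.filter (fun u => q u = true)).card + 3) :
    X.card ≤ 6 := by
  obtain ⟨N, hN, hX, hp, hq, hr⟩ := aux_counts p q r X
  have ex : ∀ x y z, N x y z ≠ 0 → ∃ u ∈ X, p u = x ∧ q u = y ∧ r u = z := by
    intro x y z h
    rw [hN] at h
    obtain ⟨u, hu⟩ := Finset.card_pos.mp (Nat.pos_of_ne_zero h)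
    exact ⟨u, (Finset.mem_filter.mp hu).1, (Finset.mem_filter.mp hu).2⟩
  have one : ∀ x, N x x x = 0 := by
    intro x
    by_contra h
    obtain ⟨u, hu, h1, h2, h3⟩ := ex _ _ _ h
    refine hmin {u} (by simpa using hu) (by simp) ?_
    cases x <;> simp [Finset.filter_singleton, h1, h2, h3]
  have two : ∀ x y z, N x y z = 0 ∨ N (!x) (!y) (!z) = 0 := by
    intro x y z
    by_contra h
    push Not at h
    obtain ⟨u, hu, a1, a2, a3⟩ := ex _ _ _ h.1
    obtain ⟨v, hv, b1, b2, b3⟩ := ex _ _ _ h.2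
    have huv : u ≠ v := by
      rintro rfl
      rw [a1] at b1
      cases x <;> simp at b1
    refine hmin {u, v} (by intro w hw; simp at hw; rcases hw with rfl | rfl <;> assumption)
      (by simp) ?_
    cases x <;> cases y <;> cases z <;>
      simp [Finset.filter_insert, Finset.filter_singleton, a1, a2, a3, b1, b2, b3]
  have three : ∀ x, N x (!x) (!x) = 0 ∨ N (!x) x (!x) = 0 ∨ N (!x) (!x) x = 0 := by
    intro x
    by_contra h
    push Not at h
    obtain ⟨u, hu, a1, a2, a3⟩ := ex _ _ _ h.1
    obtain ⟨v, hv, b1, b2, b3⟩ := ex _ _ _ h.2.1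
    obtain ⟨w, hw, c1, c2, c3⟩ := ex _ _ _ h.2.2
    have huv : u ≠ v := by
      rintro rfl
      rw [a1] at b1
      cases x <;> simp at b1
    have huw : u ≠ w := by
      rintro rfl
      rw [a1] at c1
      cases x <;> simp at c1
    have hvw : v ≠ w := by
      rintro rfl
      rw [b2] at c2
      cases x <;> simp at c2
    refine hmin {u, v, w}
      (by intro t ht; simp at ht; rcases ht with rfl | rfl | rfl <;> assumption) (by simp) ?_
    cases x <;>
      simp [Finset.filter_insert, Finset.filter_singleton, a1, a2, a3, b1, b2, b3, c1, c2, c3,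
        huv, huw, hvw]
  have o1 := one true
  have o2 := one false
  have t1 := two true false false
  have t2 := two false true false
  have t3 := two false false true
  have r1 := three true
  have r2 := three false
  simp only [Bool.not_true, Bool.not_false] at t1 t2 t3 r1 r2
  omega

/-- If `a, b, c` have equal degree inside `K`, and degrees in `G` within 3 of each other. -/
lemma aux_main {V : Type*} [Fintype V] [DecidableEq V]
    (G : SimpleGraph V) [DecidableRel G.Adj] (K : Finset V) (a b c : V)
    (ha : a ∈ K) (hb : b ∈ K) (hc : c ∈ K) (hab : a ≠ b) (hac : a ≠ c) (hbc : b ≠ c)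
    (e1 : (K.filter (fun u => G.Adj a u)).card = (K.filter (fun u => G.Adj b u)).card)
    (e2 : (K.filter (fun u => G.Adj b u)).card = (K.filter (fun u => G.Adj c u)).card)
    (hd : ∀ x ∈ ({a, b, c} : Finset V), ∀ y ∈ ({a, b, c} : Finset V),
      G.degree x ≤ G.degree y + 3) :
    ∃ X : Finset V, X.card ≤ 6 ∧
      ∃ a b c : V, a ∉ X ∧ b ∉ X ∧ c ∉ X ∧ a ≠ b ∧ a ≠ c ∧ b ≠ c ∧
        (Xᶜ.filter (fun u => G.Adj a u)).card = (Xᶜ.filter (fun u => G.Adj b u)).card ∧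
        (Xᶜ.filter (fun u => G.Adj b u)).card = (Xᶜ.filter (fun u => G.Adj c u)).card := by
  let S : Finset (Finset V) := (Kᶜ).powerset.filter (fun X =>
    (Xᶜ.filter (fun u => G.Adj a u)).card = (Xᶜ.filter (fun u => G.Adj b u)).card ∧
    (Xᶜ.filter (fun u => G.Adj b u)).card = (Xᶜ.filter (fun u => G.Adj c u)).card)
  have hS : S.Nonempty := ⟨Kᶜ, by simp [S, e1, e2]⟩
  obtain ⟨X, hXS, hXmin⟩ := S.exists_min_image Finset.card hS
  obtain ⟨hXK, f1, f2⟩ : X ⊆ Kᶜ ∧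
    (Xᶜ.filter (fun u => G.Adj a u)).card = (Xᶜ.filter (fun u => G.Adj b u)).card ∧
    (Xᶜ.filter (fun u => G.Adj b u)).card = (Xᶜ.filter (fun u => G.Adj c u)).card := by
    simpa [S] using hXS
  have hn : ∀ v ∈ K, v ∉ X := fun v hv hvX => by
    have := hXK hvX
    simp [hv] at this
  have hdeg : ∀ v, G.degree v = (X.filter (fun u => G.Adj v u)).card
      + (Xᶜ.filter (fun u => G.Adj v u)).card := by
    intro v
    rw [← Finset.card_union_of_disjoint
      (Finset.disjoint_filter_filter disjoint_compl_right), ← Finset.filter_union]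
    rw [← G.card_neighborFinset_eq_degree]
    congr 1
    ext; simp
  refine ⟨X, ?_, a, b, c, hn a ha, hn b hb, hn c hc, hab, hac, hbc, f1, f2⟩
  have da := hdeg a
  have db := hdeg b
  have dc := hdeg c
  have g1 := hd a (by simp) b (by simp)
  have g2 := hd a (by simp) c (by simp)
  have g3 := hd b (by simp) a (by simp)
  have g4 := hd b (by simp) c (by simp)
  have g5 := hd c (by simp) a (by simp)
  have g6 := hd c (by simp) b (by simp)
  apply aux_comb (fun u => decide (G.Adj a u)) (fun u => decide (G.Adj b u))
    (fun u => decide (G.Adj c u)) X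
  · intro Z hZ hne
    simp only [decide_eq_true_eq]
    rintro ⟨z1, z2⟩
    have key : ∀ v, ((X \ Z)ᶜ.filter (fun u => G.Adj v u)).card
        = (Xᶜ.filter (fun u => G.Adj v u)).card + (Z.filter (fun u => G.Adj v u)).card := by
      intro v
      rw [← Finset.card_union_of_disjoint (Finset.disjoint_filter_filter
        (Finset.disjoint_left.mpr fun u hu hz => (Finset.mem_compl.mp hu) (hZ hz))),
        ← Finset.filter_union]
      congr 2
      ext u
      simp only [Finset.mem_compl, Finset.mem_sdiff, Finset.mem_union]
      tauto
    have hmem : X \ Z ∈ S := by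
      simp only [S, Finset.mem_filter, Finset.mem_powerset, key]
      exact ⟨Finset.sdiff_subset.trans hXK, by omega, by omega⟩
    have := hXmin _ hmem
    have h2 := Finset.card_sdiff_add_card_eq_card hZ
    have := hne.card_pos
    omega
  all_goals simp only [decide_eq_true_eq]; omega

/-- Erdős–Chen–Rousseau–Schelp for five vertices. -/
lemma aux_ecrs {V : Type*} [Fintype V] [DecidableEq V]
    (G : SimpleGraph V) [DecidableRel G.Adj] (h : 5 ≤ Fintype.card V) :
    ∃ F : Finset V, F.card = 5 ∧ ∀ x ∈ F, ∀ y ∈ F, G.degree x ≤ G.degree y + 3 := by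
  obtain ⟨n, hn⟩ : ∃ n, n = Fintype.card V := ⟨_, rfl⟩
  let e0 : Fin n ≃ V := (finCongr hn).trans (Fintype.equivFin V).symm
  let e : Fin n ≃ V := (Tuple.sort (fun i => G.degree (e0 i))).trans e0
  have hmono : Monotone (fun i => G.degree (e i)) :=
    Tuple.monotone_sort (fun i => G.degree (e0 i))
  by_contra hcon
  push Not at hcon
  have step : ∀ i (hi : i + 4 < n), G.degree (e ⟨i, by omega⟩) + 4 ≤ G.degree (e ⟨i + 4, hi⟩) := by
    intro i hi
    by_contra hlt
    have hinj : Function.Injective (fun j : Fin 5 => e ⟨i + j, by omega⟩) := by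
      intro j k hjk
      have := e.injective hjk
      simp at this
      exact Fin.ext this
    obtain ⟨x, hx, y, hy, hxy⟩ := hcon
      (Finset.univ.image (fun j : Fin 5 => e ⟨i + j, by omega⟩))
      (by rw [Finset.card_image_of_injective _ hinj]; simp)
    simp only [Finset.mem_image, Finset.mem_univ, true_and] at hx hy
    obtain ⟨j, rfl⟩ := hx
    obtain ⟨k, rfl⟩ := hy
    have m1 := @hmono ⟨i + j, by omega⟩ ⟨i + 4, hi⟩ (by simp [Fin.le_def]; omega)
    have m2 := @hmono ⟨i, by omega⟩ ⟨i + k, by omega⟩ (by simp [Fin.le_def])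
    simp only at m1 m2
    omega
  have chain : ∀ m i (hi : i + 4 * m < n),
      G.degree (e ⟨i, by omega⟩) + 4 * m ≤ G.degree (e ⟨i + 4 * m, hi⟩) := by
    intro m
    induction m with
    | zero => intro i hi; simp
    | succ m ih =>
      intro i hi
      have h1 := ih i (by omega)
      have h2 := step (i + 4 * m) (by omega)
      have h3 : (⟨i + 4 * (m + 1), hi⟩ : Fin n) = ⟨i + 4 * m + 4, by omega⟩ := by
        ext; simp; omega
      rw [h3]
      omega
  obtain ⟨m, hm⟩ : ∃ m, m = (n - 1) / 4 := ⟨_, rfl⟩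
  obtain ⟨t, ht⟩ : ∃ t, t + 4 * m = n := ⟨n - 4 * m, by omega⟩
  have ht0 : 0 < t := by omega
  have htm : t ≤ 4 * m := by omega
  let lo : Fin t → V := fun i => e ⟨i, by omega⟩
  let hi : Fin t → V := fun i => e ⟨i + 4 * m, by omega⟩
  have lo_inj : Function.Injective lo := by
    intro j k hjk
    have := e.injective hjk
    simp at this
    exact Fin.ext this
  have hi_inj : Function.Injective hi := by
    intro j k hjk
    have := e.injective hjk
    simp at this
    exact Fin.ext this
  let B := Finset.univ.image lo
  let T := Finset.univ.image hi
  have cB : B.card = t := by simp [B, Finset.card_image_of_injective _ lo_inj]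
  have cT : T.card = t := by simp [T, Finset.card_image_of_injective _ hi_inj]
  have disj : ∀ u ∈ T, u ∉ B := by
    intro u hu hb
    simp only [T, B, Finset.mem_image, Finset.mem_univ, true_and] at hu hb
    obtain ⟨j, rfl⟩ := hu
    obtain ⟨k, hk⟩ := hb
    have := e.injective hk
    simp at this
    omega
  have sB : ∑ v ∈ B, G.degree v = ∑ i, G.degree (lo i) :=
    Finset.sum_image (fun _ _ _ _ h => lo_inj h)
  have sT : ∑ v ∈ T, G.degree v = ∑ i, G.degree (hi i) :=
    Finset.sum_image (fun _ _ _ _ h => hi_inj h)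
  have low : ∑ v ∈ B, G.degree v + t * (4 * m) ≤ ∑ v ∈ T, G.degree v := by
    rw [sB, sT]
    calc _ = ∑ i : Fin t, (G.degree (lo i) + 4 * m) := by simp [Finset.sum_add_distrib]
      _ ≤ _ := Finset.sum_le_sum fun i _ => chain m i (by omega)
  have dbl : ∑ u ∈ T, (B.filter (fun v => G.Adj u v)).card
      = ∑ v ∈ B, (T.filter (fun u => G.Adj u v)).card :=
    Finset.sum_card_bipartiteAbove_eq_sum_card_bipartiteBelow G.Adj
  have up1 : ∑ v ∈ B, (T.filter (fun u => G.Adj u v)).card ≤ ∑ v ∈ B, G.degree v := by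
    refine Finset.sum_le_sum fun v _ => ?_
    rw [← G.card_neighborFinset_eq_degree]
    apply Finset.card_le_card
    intro u hu
    simp at hu ⊢
    exact hu.2.symm
  have up2 : ∑ u ∈ T, G.degree u + t
      ≤ ∑ u ∈ T, (B.filter (fun v => G.Adj u v)).card + t * (4 * m) := by
    calc _ = ∑ u ∈ T, (G.degree u + 1) := by simp [Finset.sum_add_distrib, cT]
      _ ≤ ∑ u ∈ T, ((B.filter (fun v => G.Adj u v)).card + 4 * m) := by
        refine Finset.sum_le_sum fun u hu => ?_
        have hsub : insert u (G.neighborFinset u) ⊆ B.filter (fun v => G.Adj u v) ∪ Bᶜ := by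
          intro w hw
          rw [Finset.mem_insert] at hw
          rcases hw with rfl | hw
          · simp [disj w hu]
          · simp at hw ⊢
            tauto
        have h1 := Finset.card_le_card hsub
        rw [Finset.card_insert_of_notMem (by simp), G.card_neighborFinset_eq_degree] at h1
        have h2 := Finset.card_union_le (B.filter (fun v => G.Adj u v)) Bᶜ
        rw [Finset.card_compl, cB] at h2
        omega
      _ = _ := by simp [Finset.sum_add_distrib, cT]
  omega

/-- Three pairwise equally related vertices suffice. -/
lemma aux_mono {V : Type*} [DecidableEq V]
    (G : SimpleGraph V) [DecidableRel G.Adj] (a b c : V)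
    (hab : a ≠ b) (hac : a ≠ c) (hbc : b ≠ c)
    (h1 : G.Adj a b ↔ G.Adj a c) (h2 : G.Adj a b ↔ G.Adj b c) :
    ((({a, b, c} : Finset V).filter (fun u => G.Adj a u)).card
      = (({a, b, c} : Finset V).filter (fun u => G.Adj b u)).card) ∧
    ((({a, b, c} : Finset V).filter (fun u => G.Adj b u)).card
      = (({a, b, c} : Finset V).filter (fun u => G.Adj c u)).card) := by
  by_cases h : G.Adj a b
  · have h3 := h1.mp h
    have h4 := h2.mp h
    simp [Finset.filter_insert, Finset.filter_singleton, h, h3, h4, h.symm, h3.symm, h4.symm,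
      hab, hac, hbc]
  · have h3 : ¬ G.Adj a c := fun x => h (h1.mpr x)
    have h4 : ¬ G.Adj b c := fun x => h (h2.mpr x)
    simp [Finset.filter_insert, Finset.filter_singleton, h, h3, h4, G.adj_comm b a,
      G.adj_comm c a, G.adj_comm c b]

lemma aux_ramsey {V : Type*} [DecidableEq V]
    (G : SimpleGraph V) [DecidableRel G.Adj] (F : Finset V) (hF : F.card = 5) :
    ∃ K : Finset V, ∃ a b c : V, a ∈ F ∧ b ∈ F ∧ c ∈ F ∧ a ∈ K ∧ b ∈ K ∧ c ∈ K ∧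
      a ≠ b ∧ a ≠ c ∧ b ≠ c ∧
      (K.filter (fun u => G.Adj a u)).card = (K.filter (fun u => G.Adj b u)).card ∧
      (K.filter (fun u => G.Adj b u)).card = (K.filter (fun u => G.Adj c u)).card := by
  have tri : (∃ a b c : V, a ∈ F ∧ b ∈ F ∧ c ∈ F ∧ a ≠ b ∧ a ≠ c ∧ b ≠ c ∧
      (G.Adj a b ↔ G.Adj a c) ∧ (G.Adj a b ↔ G.Adj b c)) →
      ∃ K : Finset V, ∃ a b c : V, a ∈ F ∧ b ∈ F ∧ c ∈ F ∧ a ∈ K ∧ b ∈ K ∧ c ∈ K ∧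
      a ≠ b ∧ a ≠ c ∧ b ≠ c ∧
      (K.filter (fun u => G.Adj a u)).card = (K.filter (fun u => G.Adj b u)).card ∧
      (K.filter (fun u => G.Adj b u)).card = (K.filter (fun u => G.Adj c u)).card := by
    rintro ⟨a, b, c, ha, hb, hc, hab, hac, hbc, h1, h2⟩
    exact ⟨{a, b, c}, a, b, c, ha, hb, hc, by simp, by simp, by simp, hab, hac, hbc,
      aux_mono G a b c hab hac hbc h1 h2⟩
  by_cases hreg : ∀ v ∈ F, (F.filter (fun u => G.Adj v u)).card = 2
  · obtain ⟨a, b, c, ha, hb, hc, hab, hac, hbc⟩ := Finset.two_lt_card_iff.mp (by omega : 2 < F.card)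
    exact ⟨F, a, b, c, ha, hb, hc, ha, hb, hc, hab, hac, hbc,
      by rw [hreg a ha, hreg b hb], by rw [hreg b hb, hreg c hc]⟩
  · push Not at hreg
    obtain ⟨v, hv, hne⟩ := hreg
    apply tri
    have hsplit : (F.filter (fun u => G.Adj v u)).card
        + ((F.erase v).filter (fun u => ¬ G.Adj v u)).card = 4 := by
      have h1 := Finset.card_filter_add_card_filter_not (s := F.erase v) (fun u => G.Adj v u)
      have h2 : (F.erase v).filter (fun u => G.Adj v u) = F.filter (fun u => G.Adj v u) := by
        ext u
        simp only [Finset.mem_filter, Finset.mem_erase]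
        exact ⟨fun h => ⟨h.1.2, h.2⟩, fun h => ⟨⟨h.2.ne', h.1⟩, h.2⟩⟩
      rw [h2, Finset.card_erase_of_mem hv, hF] at h1
      exact h1
    rcases lt_or_gt_of_ne hne with hlt | hgt
    · obtain ⟨x, y, z, hx, hy, hz, hxy, hxz, hyz⟩ := Finset.two_lt_card_iff.mp
        (by omega : 2 < ((F.erase v).filter (fun u => ¬ G.Adj v u)).card)
      simp only [Finset.mem_filter, Finset.mem_erase] at hx hy hz
      by_cases h1 : G.Adj x y
      · by_cases h2 : G.Adj x z
        · by_cases h3 : G.Adj y z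
          · exact ⟨x, y, z, hx.1.2, hy.1.2, hz.1.2, hxy, hxz, hyz, by tauto, by tauto⟩
          · exact ⟨v, y, z, hv, hy.1.2, hz.1.2, hy.1.1.symm, hz.1.1.symm, hyz, by tauto, by tauto⟩
        · exact ⟨v, x, z, hv, hx.1.2, hz.1.2, hx.1.1.symm, hz.1.1.symm, hxz, by tauto, by tauto⟩
      · exact ⟨v, x, y, hv, hx.1.2, hy.1.2, hx.1.1.symm, hy.1.1.symm, hxy, by tauto, by tauto⟩
    · obtain ⟨x, y, z, hx, hy, hz, hxy, hxz, hyz⟩ := Finset.two_lt_card_iff.mp hgt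
      simp only [Finset.mem_filter] at hx hy hz
      by_cases h1 : G.Adj x y
      · exact ⟨v, x, y, hv, hx.1, hy.1, hx.2.ne, hy.2.ne, hxy, by tauto, by tauto⟩
      · by_cases h2 : G.Adj x z
        · exact ⟨v, x, z, hv, hx.1, hz.1, hx.2.ne, hz.2.ne, hxz, by tauto, by tauto⟩
        · by_cases h3 : G.Adj y z
          · exact ⟨v, y, z, hv, hy.1, hz.1, hy.2.ne, hz.2.ne, hyz, by tauto, by tauto⟩
          · exact ⟨x, y, z, hx.1, hy.1, hz.1, hxy, hxz, hyz, by tauto, by tauto⟩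

theorem stmt_11 {V : Type*} [Fintype V] [DecidableEq V]
    (G : SimpleGraph V) [DecidableRel G.Adj] (h : 5 ≤ Fintype.card V) :
    ∃ X : Finset V, X.card ≤ 6 ∧
      ∃ a b c : V, a ∉ X ∧ b ∉ X ∧ c ∉ X ∧ a ≠ b ∧ a ≠ c ∧ b ≠ c ∧
        (Xᶜ.filter (fun u => G.Adj a u)).card = (Xᶜ.filter (fun u => G.Adj b u)).card ∧
        (Xᶜ.filter (fun u => G.Adj b u)).card = (Xᶜ.filter (fun u => G.Adj c u)).card := by
  obtain ⟨F, hF, hd⟩ := aux_ecrs G h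
  obtain ⟨K, a, b, c, ha, hb, hc, ka, kb, kc, hab, hac, hbc, e1, e2⟩ := aux_ramsey G F hF
  have hsub : ∀ x ∈ ({a, b, c} : Finset V), x ∈ F := by
    intro x hx
    simp at hx
    rcases hx with rfl | rfl | rfl <;> assumption
  exact aux_main G K a b c ka kb kc hab hac hbc e1 e2
    (fun x hx y hy => hd x (hsub x hx) y (hsub y hy))
end

section
/- For every positive integer k, every graph G on n vertices contains an induced subgraph on at least n − (8k)^k vertices having at least min{k, n − (8k)^k} vertices with the same degree. -/
/-- Ramsey bound. -/
lemma ramsey_aux {V : Type*} [DecidableEq V] (G : SimpleGraph V) [DecidableRel G.Adj] :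
    ∀ (n a b : ℕ), a + b = n → ∀ W : Finset V, 2 ^ n ≤ W.card →
      ∃ S ⊆ W, (S.card = a ∧ ∀ x ∈ S, ∀ y ∈ S, x ≠ y → G.Adj x y) ∨
        (S.card = b ∧ ∀ x ∈ S, ∀ y ∈ S, ¬ G.Adj x y) := by
  intro n
  induction n with
  | zero =>
    intro a b hab W _
    exact ⟨∅, by simp, Or.inl ⟨by simp; omega, by simp⟩⟩
  | succ n ih =>
    intro a b hab W hW
    rcases Nat.eq_zero_or_pos a with ha | ha
    · exact ⟨∅, by simp, Or.inl ⟨by simp [ha], by simp⟩⟩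
    rcases Nat.eq_zero_or_pos b with hb | hb
    · exact ⟨∅, by simp, Or.inr ⟨by simp [hb], by simp⟩⟩
    have hpos : 0 < W.card := lt_of_lt_of_le (by positivity) hW
    obtain ⟨w, hw⟩ := Finset.card_pos.mp hpos
    have hsplit := Finset.card_filter_add_card_filter_not (s := W.erase w) (fun x => G.Adj w x)
    rw [Finset.card_erase_of_mem hw] at hsplit
    have hp : 2 ^ (n + 1) = 2 * 2 ^ n := by ring
    by_cases hN : 2 ^ n ≤ ((W.erase w).filter (fun x => G.Adj w x)).card
    · obtain ⟨S, hS, h⟩ := ih (a - 1) b (by omega) _ hN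
      have hSW : ∀ x ∈ S, x ≠ w ∧ x ∈ W ∧ G.Adj w x := by
        intro x hx
        have := hS hx
        simp only [Finset.mem_filter, Finset.mem_erase] at this
        tauto
      rcases h with ⟨hc, h⟩ | ⟨hc, h⟩
      · refine ⟨insert w S, ?_, Or.inl ⟨?_, ?_⟩⟩
        · intro x hx
          rcases Finset.mem_insert.mp hx with rfl | hx
          · exact hw
          · exact (hSW x hx).2.1
        · rw [Finset.card_insert_of_notMem (fun h' => (hSW w h').1 rfl)]; omega
        · intro x hx y hy hxy
          rcases Finset.mem_insert.mp hx with hxw | hx' <;>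
            rcases Finset.mem_insert.mp hy with hyw | hy'
          · exact absurd (hxw.trans hyw.symm) hxy
          · rw [hxw]; exact (hSW y hy').2.2
          · rw [hyw]; exact (hSW x hx').2.2.symm
          · exact h x hx' y hy' hxy
      · exact ⟨S, fun x hx => (hSW x hx).2.1, Or.inr ⟨hc, h⟩⟩
    · have hN' : 2 ^ n ≤ ((W.erase w).filter (fun x => ¬ G.Adj w x)).card := by omega
      obtain ⟨S, hS, h⟩ := ih a (b - 1) (by omega) _ hN'
      have hSW : ∀ x ∈ S, x ≠ w ∧ x ∈ W ∧ ¬ G.Adj w x := by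
        intro x hx
        have := hS hx
        simp only [Finset.mem_filter, Finset.mem_erase] at this
        tauto
      rcases h with ⟨hc, h⟩ | ⟨hc, h⟩
      · exact ⟨S, fun x hx => (hSW x hx).2.1, Or.inl ⟨hc, h⟩⟩
      · refine ⟨insert w S, ?_, Or.inr ⟨?_, ?_⟩⟩
        · intro x hx
          rcases Finset.mem_insert.mp hx with rfl | hx
          · exact hw
          · exact (hSW x hx).2.1
        · rw [Finset.card_insert_of_notMem (fun h' => (hSW w h').1 rfl)]; omega
        · intro x hx y hy
          rcases Finset.mem_insert.mp hx with hxw | hx' <;>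
            rcases Finset.mem_insert.mp hy with hyw | hy'
          · rw [hxw, hyw]; exact G.loopless.irrefl _
          · rw [hxw]; exact (hSW y hy').2.2
          · rw [hyw]; exact fun h' => (hSW x hx').2.2 h'.symm
          · exact h x hx' y hy'

/-- The Grinberg--Sevastyanov invariant. -/
def GS {ι J : Type*} [Fintype ι] [Fintype J] (v : ι → J → ℝ) (A : Finset ι) : Prop :=
  A.card ≤ Fintype.card J ∨ ∃ l : ι → ℝ, (∀ i, 0 ≤ l i ∧ l i ≤ 1) ∧ (∀ i, i ∉ A → l i = 0) ∧
    ∑ i, l i = (A.card : ℝ) - Fintype.card J ∧ ∀ j, ∑ i, l i * v i j = 0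

lemma GS_bound {ι J : Type*} [Fintype ι] [DecidableEq ι] [Fintype J] (v : ι → J → ℝ)
    (hv : ∀ i j, |v i j| ≤ 1) (A : Finset ι) (h : GS v A) (j : J) :
    |∑ i ∈ A, v i j| ≤ Fintype.card J := by
  rcases h with h | ⟨l, h01, h0, hs, hz⟩
  · calc |∑ i ∈ A, v i j| ≤ ∑ i ∈ A, |v i j| := Finset.abs_sum_le_sum_abs _ _
      _ ≤ ∑ i ∈ A, (1 : ℝ) := Finset.sum_le_sum (fun i _ => hv i j)
      _ = A.card := by simp
      _ ≤ Fintype.card J := by exact_mod_cast h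
  · have e1 : ∑ i ∈ A, l i = ∑ i, l i :=
      Finset.sum_subset (Finset.subset_univ _) (fun i _ hi => h0 i hi)
    have e2 : ∑ i ∈ A, l i * v i j = 0 := by
      rw [← hz j]
      exact Finset.sum_subset (Finset.subset_univ _) (fun i _ hi => by rw [h0 i hi, zero_mul])
    have e3 : ∑ i ∈ A, v i j = ∑ i ∈ A, (1 - l i) * v i j := by
      simp only [sub_mul, one_mul, Finset.sum_sub_distrib, e2, sub_zero]
    rw [e3]
    calc |∑ i ∈ A, (1 - l i) * v i j| ≤ ∑ i ∈ A, |(1 - l i) * v i j| :=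
          Finset.abs_sum_le_sum_abs _ _
      _ ≤ ∑ i ∈ A, (1 - l i) := by
          refine Finset.sum_le_sum (fun i _ => ?_)
          rw [abs_mul, abs_of_nonneg (by linarith [(h01 i).2])]
          exact mul_le_of_le_one_right (by linarith [(h01 i).2]) (hv i j)
      _ = Fintype.card J := by
          rw [Finset.sum_sub_distrib, e1, hs]; simp

lemma GS_step {ι J : Type*} [Fintype ι] [DecidableEq ι] [Fintype J] (v : ι → J → ℝ)
    (A : Finset ι) (hA : A.Nonempty) (h : GS v A) : ∃ a ∈ A, GS v (A.erase a) := by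
  by_cases hc : A.card ≤ Fintype.card J + 1
  · obtain ⟨a, ha⟩ := hA
    refine ⟨a, ha, Or.inl ?_⟩
    rw [Finset.card_erase_of_mem ha]; omega
  push Not at hc
  rcases h with h | ⟨l, h01, h0, hs, hz⟩
  · omega
  have hcR : (Fintype.card J : ℝ) + 1 < A.card := by exact_mod_cast hc
  set d : ℝ := (Fintype.card J : ℝ) with hd
  set p : ℝ := (A.card : ℝ) with hp
  let K : Set (ι → ℝ) := {m | (∀ i, 0 ≤ m i ∧ m i ≤ 1) ∧ (∀ i, i ∉ A → m i = 0) ∧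
    ∑ i, m i = p - 1 - d ∧ ∀ j, ∑ i, m i * v i j = 0}
  have hK : IsCompact K := by
    refine IsCompact.of_isClosed_subset (isCompact_Icc (a := (0 : ι → ℝ)) (b := 1)) ?_ ?_
    · simp only [K, Set.ofPred_and, Set.ofPred_forall]
      refine IsClosed.inter ?_ (IsClosed.inter ?_ (IsClosed.inter ?_ ?_))
      · refine isClosed_iInter fun i => IsClosed.inter ?_ ?_
        · exact isClosed_le (by fun_prop) (by fun_prop)
        · exact isClosed_le (by fun_prop) (by fun_prop)
      · refine isClosed_iInter fun i => isClosed_iInter fun _ => ?_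
        exact isClosed_eq (by fun_prop) (by fun_prop)
      · exact isClosed_eq (by fun_prop) (by fun_prop)
      · refine isClosed_iInter fun i => ?_
        exact isClosed_eq (by fun_prop) (by fun_prop)
    · intro m hm
      exact ⟨fun i => (hm.1 i).1, fun i => (hm.1 i).2⟩
  have hne : K.Nonempty := by
    have hc0 : 0 ≤ (p - 1 - d) / (p - d) := div_nonneg (by linarith) (by linarith)
    have hc1 : (p - 1 - d) / (p - d) ≤ 1 := by
      rw [div_le_one (by linarith)]; linarith
    refine ⟨fun i => (p - 1 - d) / (p - d) * l i, ?_, ?_, ?_, ?_⟩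
    · exact fun i => ⟨mul_nonneg hc0 (h01 i).1, mul_le_one₀ hc1 (h01 i).1 (h01 i).2⟩
    · intro i hi; simp [h0 i hi]
    · rw [← Finset.mul_sum, hs]
      exact div_mul_cancel₀ _ (by linarith)
    · intro j
      simp only [mul_assoc, ← Finset.mul_sum, hz j, mul_zero]
  obtain ⟨m, hmK⟩ := hK.extremePoints_nonempty hne
  obtain ⟨⟨m01, m0, ms, mz⟩, hext⟩ := mem_extremePoints.mp hmK
  suffices hex : ∃ a ∈ A, m a = 0 by
    obtain ⟨a, ha, hma⟩ := hex
    refine ⟨a, ha, Or.inr ⟨m, m01, ?_, ?_, mz⟩⟩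
    · intro i hi
      by_cases hia : i = a
      · rw [hia, hma]
      · exact m0 i (fun h' => hi (Finset.mem_erase.mpr ⟨hia, h'⟩))
    · rw [ms, Finset.card_erase_of_mem ha, Nat.cast_sub (by omega)]
      push_cast; rfl
  by_contra hno
  push Not at hno
  let F : Finset ι := A.filter (fun i => m i < 1)
  have hFpos : ∀ i ∈ F, 0 < m i ∧ m i < 1 := by
    intro i hi
    have := Finset.mem_filter.mp hi
    exact ⟨lt_of_le_of_ne (m01 i).1 (Ne.symm (hno i this.1)), this.2⟩
  have hsumA : ∑ i ∈ A, m i = p - 1 - d := by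
    rw [← ms]; exact Finset.sum_subset (Finset.subset_univ _) (fun i _ hi => m0 i hi)
  have hsumF : ∑ i ∈ F, (1 - m i) = d + 1 := by
    have : ∑ i ∈ F, (1 - m i) = ∑ i ∈ A, (1 - m i) := by
      refine Finset.sum_subset (Finset.filter_subset _ _) (fun i hi hiF => ?_)
      have : ¬ m i < 1 := fun h' => hiF (Finset.mem_filter.mpr ⟨hi, h'⟩)
      linarith [(m01 i).2]
    rw [this, Finset.sum_sub_distrib, hsumA]; simp [← hp]; ring
  have hFne : F.Nonempty := by
    rw [Finset.nonempty_iff_ne_empty]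
    intro hF
    rw [hF] at hsumF
    have : (0 : ℝ) ≤ d := by positivity
    simp at hsumF; linarith
  have hFcard : Fintype.card J + 1 < F.card := by
    have : ∑ i ∈ F, (1 - m i) < ∑ i ∈ F, (1 : ℝ) :=
      Finset.sum_lt_sum_of_nonempty hFne (fun i hi => by linarith [(hFpos i hi).1])
    rw [hsumF] at this
    simp at this
    rw [hd] at this
    exact_mod_cast this
  let L : (F → ℝ) →ₗ[ℝ] (Option J → ℝ) :=
    { toFun := fun w o => ∑ i : F, w i * (o.elim 1 (fun j => v i j))
      map_add' := by
        intro x y; ext o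
        simp [add_mul, Finset.sum_add_distrib]
      map_smul' := by
        intro c x; ext o
        simp [mul_assoc, Finset.mul_sum] }
  have hker : LinearMap.ker L ≠ ⊥ := by
    apply LinearMap.ker_ne_bot_of_finrank_lt
    simp
    exact hFcard
  obtain ⟨w, hwk, hw0⟩ := Submodule.exists_mem_ne_zero_of_ne_bot hker
  have hL : ∀ o : Option J, ∑ i : F, w i * (o.elim 1 (fun j => v i j)) = 0 := by
    intro o; exact congrFun (LinearMap.mem_ker.mp hwk) o
  let w' : ι → ℝ := fun i => if h : i ∈ F then w ⟨i, h⟩ else 0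
  have hw'0 : ∀ i, i ∉ F → w' i = 0 := fun i hi => by simp [w', hi]
  have hw'F : ∀ i : F, w' i = w i := fun i => by simp [w']
  have hsum : ∀ f : ι → ℝ, ∑ i, w' i * f i = ∑ i : F, w i * f i := by
    intro f
    rw [← Finset.sum_subset (Finset.subset_univ F) (fun i _ hi => by rw [hw'0 i hi, zero_mul]),
      ← Finset.sum_coe_sort]
    exact Finset.sum_congr rfl (fun i _ => by rw [hw'F])
  have hw1 : ∑ i, w' i = 0 := by
    have := hsum (fun _ => 1)
    have h2 := hL none
    simp at this h2
    rw [this, h2]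
  have hwv : ∀ j, ∑ i, w' i * v i j = 0 := by
    intro j
    rw [hsum (fun i => v i j)]
    exact hL (some j)
  have hev : ∀ᶠ t : ℝ in nhds 0, ∀ i ∈ F, (0 < m i + t * w' i ∧ m i + t * w' i < 1) := by
    rw [Filter.eventually_all_finset]
    intro i hi
    have hcont : Continuous (fun t : ℝ => m i + t * w' i) := by fun_prop
    have := hcont.tendsto 0
    simp only [zero_mul, add_zero] at this
    exact this.eventually (Ioo_mem_nhds (hFpos i hi).1 (hFpos i hi).2)
  have hmem : ∀ t : ℝ, (∀ i ∈ F, (0 < m i + t * w' i ∧ m i + t * w' i < 1)) →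
      (fun i => m i + t * w' i) ∈ K := by
    intro t ht
    refine ⟨?_, ?_, ?_, ?_⟩
    · intro i
      by_cases hi : i ∈ F
      · exact ⟨(ht i hi).1.le, (ht i hi).2.le⟩
      · simpa [hw'0 i hi] using m01 i
    · intro i hi
      have : i ∉ F := fun h' => hi (Finset.mem_filter.mp h').1
      simp [hw'0 i this, m0 i hi]
    · rw [Finset.sum_add_distrib, ← Finset.mul_sum, hw1, ms]; ring
    · intro j
      simp only [add_mul, mul_assoc, Finset.sum_add_distrib, ← Finset.mul_sum, hwv j, mz j]
      ring
  obtain ⟨ε, hε, hball⟩ := Metric.eventually_nhds_iff.mp hev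
  have hp1 := hmem (ε / 2) (hball (by simp [abs_of_pos hε]; linarith))
  have hp2 := hmem (-(ε / 2)) (hball (by simp [abs_of_pos hε]; linarith))
  have hseg : m ∈ openSegment ℝ (fun i => m i + ε / 2 * w' i) (fun i => m i + -(ε / 2) * w' i) := by
    refine ⟨1/2, 1/2, by norm_num, by norm_num, by norm_num, ?_⟩
    ext i
    simp
    ring
  have heq := (hext _ hp1 _ hp2 hseg).1
  apply hw0
  ext i
  have := congrFun heq i
  simp only [hw'F] at this
  have h3 : ε / 2 * w i = 0 := by linarith
  rcases mul_eq_zero.mp h3 with h4 | h4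
  · linarith
  · simpa using h4

lemma GS_chain {ι J : Type*} [Fintype ι] [DecidableEq ι] [Fintype J] (v : ι → J → ℝ) :
    ∀ (n : ℕ) (B : Finset ι), B.card = n → GS v B →
      ∃ A : ℕ → Finset ι, Monotone A ∧ (∀ t, A t ⊆ B) ∧ (∀ t ≤ n, (A t).card = t) ∧
        ∀ t, GS v (A t) := by
  intro n
  induction n with
  | zero =>
    intro B hB h
    exact ⟨fun _ => B, fun _ _ _ => le_rfl, fun _ => subset_rfl,
      fun t ht => by simp only [hB]; omega, fun _ => h⟩
  | succ n ih =>
    intro B hB h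
    obtain ⟨a, ha, h'⟩ := GS_step v B (Finset.card_pos.mp (by omega)) h
    obtain ⟨A, hm, hs, hc, hg⟩ := ih (B.erase a) (by rw [Finset.card_erase_of_mem ha]; omega) h'
    refine ⟨fun t => if t ≤ n then A t else B, ?_, ?_, ?_, ?_⟩
    · intro s t hst
      by_cases h1 : t ≤ n
      · simp only [h1, le_trans hst h1, if_true]; exact hm hst
      · by_cases h2 : s ≤ n
        · simp only [h1, h2, if_true, if_false]
          exact (hs s).trans (Finset.erase_subset _ _)
        · simp only [h1, h2, if_false]; exact le_rfl
    · intro t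
      by_cases h1 : t ≤ n
      · simp only [h1, if_true]; exact (hs t).trans (Finset.erase_subset _ _)
      · simp only [h1, if_false]; exact subset_rfl
    · intro t ht
      by_cases h1 : t ≤ n
      · simp only [h1, if_true]; exact hc t h1
      · simp only [h1, if_false]; omega
    · intro t
      by_cases h1 : t ≤ n
      · simp only [h1, if_true]; exact hg t
      · simp only [h1, if_false]; exact h

lemma GS_univ {ι J : Type*} [Fintype ι] [DecidableEq ι] [Fintype J] (v : ι → J → ℝ)
    (hz : ∀ j, ∑ i, v i j = 0) : GS v Finset.univ := by
  by_cases h : Fintype.card ι ≤ Fintype.card J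
  · exact Or.inl (by simpa using h)
  · push Not at h
    have hR : (Fintype.card J : ℝ) < Fintype.card ι := by exact_mod_cast h
    have h0 : (0 : ℝ) ≤ Fintype.card J := by positivity
    refine Or.inr ⟨fun _ => ((Fintype.card ι : ℝ) - Fintype.card J) / Fintype.card ι, ?_, ?_, ?_, ?_⟩
    · intro i
      refine ⟨div_nonneg (by linarith) (by linarith), ?_⟩
      rw [div_le_one (by linarith)]; linarith
    · simp
    · simp
      have : (Fintype.card ι : ℝ) ≠ 0 := by linarith
      field_simp
    · intro j
      rw [← Finset.mul_sum, hz, mul_zero]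

lemma steinitz_int {ι J : Type*} [Fintype ι] [DecidableEq ι] [Fintype J] (v : ι → J → ℤ)
    (hv : ∀ i j, |v i j| ≤ 1) (hz : ∀ j, ∑ i, v i j = 0) :
    ∃ A : ℕ → Finset ι, Monotone A ∧ (∀ t ≤ Fintype.card ι, (A t).card = t) ∧
      ∀ t j, |∑ i ∈ A t, v i j| ≤ Fintype.card J := by
  have hz' : ∀ j, ∑ i, ((v i j : ℤ) : ℝ) = 0 := fun j => by exact_mod_cast hz j
  obtain ⟨A, hm, -, hc, hg⟩ := GS_chain (fun i j => (v i j : ℝ)) (Fintype.card ι) Finset.univ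
    Finset.card_univ (GS_univ _ hz')
  refine ⟨A, hm, hc, fun t j => ?_⟩
  have := GS_bound (fun i j => (v i j : ℝ)) (fun i j => by exact_mod_cast hv i j) (A t) (hg t) j
  exact_mod_cast this

/-- Sets of vectors without a nonempty zero-sum subset are small. -/
lemma zero_sum_free {α J : Type*} [DecidableEq α] [Fintype J] [DecidableEq J]
    (v : α → J → ℤ) (hv : ∀ i j, |v i j| ≤ 1) (m : ℕ) (W : Finset α)
    (hm : ∀ j, |∑ i ∈ W, v i j| ≤ m)
    (hfree : ∀ Z ⊆ W, (∀ j, ∑ i ∈ Z, v i j = 0) → Z = ∅) :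
    W.card ≤ (m + 1) * (2 * Fintype.card J + 1) ^ Fintype.card J := by
  let z : J → ℤ := fun j => ∑ i ∈ W, v i j
  let u : W ⊕ Fin m → J → ℤ := Sum.elim (fun i j => v i j)
    (fun i j => if (i : ℕ) < (z j).natAbs then -(z j).sign else 0)
  have hu : ∀ i j, |u i j| ≤ 1 := by
    rintro (i | i) j
    · exact hv i j
    · simp only [u, Sum.elim_inr]
      split_ifs
      · rw [abs_neg]
        rcases lt_trichotomy (z j) 0 with h | h | h
        · simp [Int.sign_eq_neg_one_of_neg h]
        · simp [h]
        · simp [Int.sign_eq_one_of_pos h]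
      · simp
  have huz : ∀ j, ∑ i, u i j = 0 := by
    intro j
    rw [Fintype.sum_sum_type]
    simp only [u, Sum.elim_inl, Sum.elim_inr]
    rw [Finset.sum_coe_sort W (fun i => v i j),
      Fin.sum_univ_eq_sum_range (fun i => if i < (z j).natAbs then -(z j).sign else 0) m,
      ← Finset.sum_filter]
    have hle : (z j).natAbs ≤ m := by
      have := hm j
      change |z j| ≤ m at this
      rw [Int.abs_eq_natAbs] at this
      exact_mod_cast this
    have : (Finset.range m).filter (fun i => i < (z j).natAbs) = Finset.range (z j).natAbs := by
      ext i; simp; omega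
    rw [this]
    simp only [Finset.sum_const, Finset.card_range, nsmul_eq_mul]
    change z j + _ = 0
    have := Int.sign_mul_natAbs (z j)
    push_cast at this ⊢
    linarith
  obtain ⟨A, hmono, hcard, hbd⟩ := steinitz_int u hu huz
  let d := Fintype.card J
  let T : Finset (ℕ × (J → ℤ)) :=
    Finset.range (m + 1) ×ˢ Fintype.piFinset (fun _ : J => Finset.Icc (-(d : ℤ)) d)
  let f : ℕ → ℕ × (J → ℤ) := fun t =>
    (((A t).filter (fun x => x.isRight)).card, fun j => ∑ i ∈ A t, u i j)
  have hT : T.card = (m + 1) * (2 * Fintype.card J + 1) ^ Fintype.card J := by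
    simp only [T, Finset.card_product, Finset.card_range, Fintype.card_piFinset, Int.card_Icc,
      Finset.prod_const, Finset.card_univ]
    congr 2
    simp only [d]; omega
  have hN : Fintype.card (W ⊕ Fin m) = W.card + m := by simp
  have hle : (Finset.range (W.card + m + 1)).card ≤ T.card := by
    refine Finset.card_le_card_of_injOn f ?_ ?_
    · intro t _
      simp only [T, f, Finset.coe_product, Set.mem_prod, Finset.mem_coe, Finset.mem_range,
        Fintype.mem_piFinset, Finset.mem_Icc]
      refine ⟨?_, fun j => abs_le.mp (hbd t j)⟩
      have h1 : (A t).filter (fun x => x.isRight) ⊆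
          (Finset.univ : Finset (Fin m)).map ⟨Sum.inr, Sum.inr_injective⟩ := by
        intro x hx
        rcases x with x | x
        · simp at hx
        · simp
      have := Finset.card_le_card h1
      simp at this
      omega
    · have key : ∀ s t, s < t → t ≤ W.card + m → f s = f t → False := by
        intro s t hst ht hf
        have hsub : A s ⊆ A t := hmono hst.le
        have hf1 := congrArg Prod.fst hf
        have hf2 := congrArg Prod.snd hf
        simp only [f] at hf1 hf2
        have hR : (A s).filter (fun x => x.isRight) = (A t).filter (fun x => x.isRight) :=
          Finset.eq_of_subset_of_card_le (Finset.filter_subset_filter _ hsub) hf1.ge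
        let D := A t \ A s
        have hDcard : 0 < D.card := by
          rw [Finset.card_sdiff_of_subset hsub, hcard t (by omega), hcard s (by omega)]; omega
        have hDleft : ∀ x ∈ D, ∃ y : W, x = Sum.inl y := by
          intro x hx
          have hx' := Finset.mem_sdiff.mp hx
          rcases x with x | x
          · exact ⟨x, rfl⟩
          · exfalso
            have : Sum.inr x ∈ (A t).filter (fun x => x.isRight) := by simp [hx'.1]
            rw [← hR] at this
            exact hx'.2 (Finset.mem_filter.mp this).1
        have hDsum : ∀ j, ∑ i ∈ D, u i j = 0 := by
          intro j
          have h1 := Finset.sum_sdiff hsub (f := fun i => u i j)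
          have h2 := congrFun hf2 j
          change ∑ i ∈ D, u i j + _ = _ at h1
          linarith
        let Z : Finset α := W.filter (fun a => ∃ h : a ∈ W, Sum.inl ⟨a, h⟩ ∈ D)
        have hZsum : ∀ j, ∑ i ∈ Z, v i j = ∑ i ∈ D, u i j := by
          intro j
          refine Finset.sum_bij (fun a ha => Sum.inl ⟨a, (Finset.mem_filter.mp ha).1⟩) ?_ ?_ ?_ ?_
          · intro a ha
            obtain ⟨_, h⟩ := (Finset.mem_filter.mp ha).2
            exact h
          · intro a _ b _ hab
            simpa using hab
          · intro x hx
            obtain ⟨y, rfl⟩ := hDleft x hx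
            exact ⟨y, Finset.mem_filter.mpr ⟨y.2, y.2, hx⟩, rfl⟩
          · intro a _
            rfl
        have hZ := hfree Z (Finset.filter_subset _ _) (fun j => by rw [hZsum, hDsum])
        obtain ⟨x, hx⟩ := Finset.card_pos.mp hDcard
        obtain ⟨y, rfl⟩ := hDleft x hx
        have : (y : α) ∈ Z := Finset.mem_filter.mpr ⟨y.2, y.2, hx⟩
        rw [hZ] at this
        simp at this
      intro s hs t ht hst
      simp only [Finset.coe_range, Set.mem_Iio] at hs ht
      rcases lt_trichotomy s t with h | h | h
      · exact (key s t h (by omega) hst).elim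
      · exact h
      · exact (key t s h (by omega) hst.symm).elim
  rw [hT, Finset.card_range] at hle
  omega

lemma short_subset {α J : Type*} [DecidableEq α] [Fintype J] [DecidableEq J]
    (v : α → J → ℤ) (hv : ∀ i j, |v i j| ≤ 1) (m : ℕ) (U : Finset α)
    (hm : ∀ j, |∑ i ∈ U, v i j| ≤ m) :
    ∃ W ⊆ U, (∀ j, ∑ i ∈ W, v i j = ∑ i ∈ U, v i j) ∧
      W.card ≤ (m + 1) * (2 * Fintype.card J + 1) ^ Fintype.card J := by
  let P : Finset (Finset α) := U.powerset.filter (fun W => ∀ j, ∑ i ∈ W, v i j = ∑ i ∈ U, v i j)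
  have hP : P.Nonempty := ⟨U, by simp [P]⟩
  obtain ⟨W, hW, hmin⟩ := Finset.exists_min_image P Finset.card hP
  obtain ⟨hWU, hWs⟩ := Finset.mem_filter.mp hW
  rw [Finset.mem_powerset] at hWU
  refine ⟨W, hWU, hWs, zero_sum_free v hv m W (fun j => by rw [hWs]; exact hm j) ?_⟩
  intro Z hZ hz
  have hmem : W \ Z ∈ P := by
    refine Finset.mem_filter.mpr ⟨Finset.mem_powerset.mpr (Finset.sdiff_subset.trans hWU), ?_⟩
    intro j
    have := Finset.sum_sdiff hZ (f := fun i => v i j)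
    rw [hz j, add_zero] at this
    rw [this, hWs]
  have := hmin _ hmem
  rw [Finset.card_sdiff_of_subset hZ] at this
  have h2 := Finset.card_le_card hZ
  exact Finset.card_eq_zero.mp (by omega)

/-- Many vertices with close degrees. -/
lemma close_degrees {V : Type*} [Fintype V] [DecidableEq V] (f : V → ℕ)
    (hf : ∀ v, f v < Fintype.card V) (K : ℕ) (hK : 0 < K) (hn : K ^ 2 < Fintype.card V) :
    ∃ W : Finset V, K ≤ W.card ∧ ∀ x ∈ W, ∀ y ∈ W, f x < f y + K := by
  set n := Fintype.card V with hn'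
  have hmap : ∀ v ∈ (Finset.univ : Finset V), f v / K ∈ Finset.range (n / K + 1) := by
    intro v _
    rw [Finset.mem_range]
    have := Nat.div_le_div_right (c := K) (hf v).le
    omega
  obtain ⟨q, _, hq⟩ := Finset.exists_lt_card_fiber_of_mul_lt_card_of_maps_to
    (n := K - 1) hmap (by
      rw [Finset.card_range, Finset.card_univ, ← hn']
      obtain ⟨L, rfl⟩ : ∃ L, K = L + 1 := ⟨K - 1, by omega⟩
      have h1 := Nat.div_mul_le_self n (L + 1)
      simp only [Nat.add_sub_cancel]
      have h2 : L + 1 ≤ n / (L + 1) := by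
        rw [Nat.le_div_iff_mul_le (by omega)]; nlinarith
      nlinarith)
  refine ⟨_, Nat.le_of_pred_lt hq, ?_⟩
  · intro x hx y hy
    have hx := (Finset.mem_filter.mp hx).2
    have hy := (Finset.mem_filter.mp hy).2
    have h1 := Nat.div_add_mod (f x) K
    have h2 := Nat.div_add_mod (f y) K
    have h3 := Nat.mod_lt (f x) hK
    rw [hx] at h1
    rw [hy] at h2
    omega

theorem stmt_15 (k : ℕ) (hk : 0 < k) {V : Type*} [Fintype V] [DecidableEq V]
    (G : SimpleGraph V) [DecidableRel G.Adj] :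
    ∃ X : Finset V, X.card ≤ (8 * k) ^ k ∧
      ∃ T : Finset V, (∀ v ∈ T, v ∉ X) ∧
        min k (Fintype.card V - (8 * k) ^ k) ≤ T.card ∧
        ∀ u ∈ T, ∀ v ∈ T,
          (Xᶜ.filter (fun a => G.Adj u a)).card = (Xᶜ.filter (fun a => G.Adj v a)).card := by
  by_cases hn : Fintype.card V ≤ (8 * k) ^ k
  · exact ⟨∅, by simp, ∅, by simp, by simp; omega, by simp⟩
  push Not at hn
  rcases Nat.lt_or_ge k 2 with hk1 | hk2
  · obtain rfl : k = 1 := by omega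
    obtain ⟨x⟩ : Nonempty V := Fintype.card_pos_iff.mp (by omega)
    exact ⟨∅, by simp, {x}, by simp, by simp, by simp⟩
  have hKn : (4 ^ k) ^ 2 < Fintype.card V := by
    refine lt_of_le_of_lt ?_ hn
    rw [← pow_mul, mul_comm k 2, pow_mul]
    exact Nat.pow_le_pow_left (by omega) k
  obtain ⟨W, hWc, hWd⟩ := close_degrees (fun v => G.degree v) (fun v => G.degree_lt_card_verts v)
    (4 ^ k) (by positivity) hKn
  obtain ⟨S, hSW, hS⟩ := ramsey_aux G (2 * k) k k (by omega) W (by rw [pow_mul]; exact hWc)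
  have hScard : S.card = k := by rcases hS with h | h <;> exact h.1
  obtain ⟨c, hc⟩ : ∃ c, ∀ s ∈ S, (S.filter (fun a => G.Adj s a)).card = c := by
    rcases hS with ⟨-, h⟩ | ⟨-, h⟩
    · refine ⟨k - 1, fun s hs => ?_⟩
      have : S.filter (fun a => G.Adj s a) = S.erase s := by
        ext a
        simp only [Finset.mem_filter, Finset.mem_erase]
        constructor
        · rintro ⟨h1, h2⟩; exact ⟨h2.ne', h1⟩
        · rintro ⟨h1, h2⟩; exact ⟨h2, h s hs a h2 (Ne.symm h1)⟩
      rw [this, Finset.card_erase_of_mem hs, hScard]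
    · refine ⟨0, fun s hs => ?_⟩
      rw [Finset.card_eq_zero, Finset.filter_eq_empty_iff]
      exact fun a ha => h s hs a ha
  obtain ⟨s0, hs0⟩ : S.Nonempty := Finset.card_pos.mp (by omega)
  let v : V → {x // x ∈ S.erase s0} → ℤ := fun u s =>
    (if G.Adj s u then 1 else 0) - (if G.Adj s0 u then 1 else 0)
  have hv : ∀ u s, |v u s| ≤ 1 := by
    intro u s
    simp only [v]
    split_ifs <;> simp
  have hvsum : ∀ (U : Finset V) s, ∑ u ∈ U, v u s =
      ((U.filter (fun a => G.Adj s a)).card : ℤ) - (U.filter (fun a => G.Adj s0 a)).card := by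
    intro U s
    simp only [v, Finset.sum_sub_distrib, Finset.sum_boole]
  have hsplit : ∀ (U : Finset V) (s : V), (U.filter (fun a => G.Adj s a)).card +
      (Uᶜ.filter (fun a => G.Adj s a)).card = G.degree s := by
    intro U s
    rw [← G.card_neighborFinset_eq_degree, G.neighborFinset_eq_filter,
      ← Finset.card_union_of_disjoint, ← Finset.filter_union, Finset.union_compl]
    exact Finset.disjoint_filter_filter disjoint_compl_right
  have htot : ∀ s, ∑ u ∈ Sᶜ, v u s = (G.degree (s : V) : ℤ) - G.degree s0 := by
    intro s
    have hs := Finset.mem_of_mem_erase s.2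
    rw [hvsum]
    have h1 := hsplit S s
    have h2 := hsplit S s0
    rw [hc _ hs] at h1
    rw [hc _ hs0] at h2
    omega
  obtain ⟨X, hXS, hXs, hXc⟩ := short_subset v hv (4 ^ k - 1) Sᶜ (by
    intro s
    have hs := Finset.mem_of_mem_erase s.2
    have h1 := hWd s (hSW hs) s0 (hSW hs0)
    have h2 := hWd s0 (hSW hs0) s (hSW hs)
    rw [htot, abs_le]
    have : 0 < 4 ^ k := by positivity
    generalize 4 ^ k = q at *
    constructor <;> omega)
  have hcJ : Fintype.card {x // x ∈ S.erase s0} = k - 1 := by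
    rw [Fintype.card_coe, Finset.card_erase_of_mem hs0, hScard]
  refine ⟨X, ?_, S, ?_, ?_, ?_⟩
  · refine hXc.trans ?_
    rw [hcJ, Nat.sub_add_cancel (Nat.one_le_pow _ _ (by norm_num))]
    calc 4 ^ k * (2 * (k - 1) + 1) ^ (k - 1) ≤ 4 ^ k * (2 * k) ^ (k - 1) := by
          gcongr; omega
      _ ≤ 4 ^ k * (2 * k) ^ k := by
          gcongr <;> omega
      _ = (8 * k) ^ k := by rw [← mul_pow]; congr 1; ring
  · intro s hs hsX
    exact (Finset.mem_compl.mp (hXS hsX)) hs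
  · rw [hScard]; exact min_le_left _ _
  · have key : ∀ s ∈ S, (Xᶜ.filter (fun a => G.Adj s a)).card =
        (Xᶜ.filter (fun a => G.Adj s0 a)).card := by
      intro s hs
      by_cases h : s = s0
      · rw [h]
      · have h1 := hXs ⟨s, Finset.mem_erase.mpr ⟨h, hs⟩⟩
        rw [htot, hvsum] at h1
        have h2 := hsplit X s
        have h3 := hsplit X s0
        simp only at h1
        omega
    intro a ha b hb
    rw [key a ha, key b hb]
end
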